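/- arXiv:1010.5205 — 2 statements merged into one kernel-verified Lean document; each statement's English description precedes it below -/
import Mathlib

section
/- Let D̄ be a closed disc in ℂ with centre 0 and let ψ = (ψ₁, ψ₂) : ℂ² → ℂ² be a holomorphic automorphism of ℂ² (i.e., ψ is bijective, and ψ and ψ⁻¹ are holomorphic) such that ψ(D̄ × ℂ) = D̄ × ℂ. Then there exist φ ∈ ℝ and entire functions 𝒢, ℋ : ℂ → ℂ, with 𝒢 nowhere vanishing, such that ψ(z, w) = (e^{iφ} z, 𝒢(z)w + ℋ(z)) for all (z, w) ∈ ℂ². Conversely, every map of this form is a holomorphic automorphism of ℂ² mapping D̄ × ℂ onto itself. -/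
open Complex Metric

/-- The difference quotient of an entire function is entire. -/
theorem Differentiable.dslope {f : ℂ → ℂ} (hf : Differentiable ℂ f) (c : ℂ) :
    Differentiable ℂ (dslope f c) := by
  rw [← differentiableOn_univ] at hf ⊢
  exact (differentiableOn_dslope Filter.univ_mem).2 hf

/-- An entire function of at most linear growth is affine. -/
theorem eq_add_mul_of_linear_growth {k : ℂ → ℂ} (hk : Differentiable ℂ k) {R : ℝ} (hR : 1 ≤ R)
    (hb : ∀ w, R < ‖w‖ → ‖k w‖ ≤ ‖w‖) : ∃ c : ℂ, ∀ w, k w = k 0 + c * w := by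
  have hd := hk.dslope 0
  obtain ⟨C, hC⟩ := (isCompact_closedBall (0 : ℂ) R).exists_bound_of_continuousOn
    hd.continuous.continuousOn
  have hbd : Bornology.IsBounded (Set.range (dslope k 0)) := by
    refine isBounded_iff_forall_norm_le.2 ⟨max C (1 + ‖k 0‖), ?_⟩
    rintro _ ⟨w, rfl⟩
    rcases le_or_gt ‖w‖ R with hw | hw
    · exact (hC w (by simpa using hw)).trans (le_max_left _ _)
    · refine le_trans ?_ (le_max_right _ _)
      have hw1 : 1 ≤ ‖w‖ := hR.trans hw.le
      have hw0 : w ≠ 0 := norm_pos_iff.1 (by linarith)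
      rw [dslope_of_ne _ hw0, slope_def_field, norm_div, sub_zero, div_le_iff₀ (by linarith)]
      calc ‖k w - k 0‖ ≤ ‖k w‖ + ‖k 0‖ := norm_sub_le _ _
        _ ≤ (1 + ‖k 0‖) * ‖w‖ := by nlinarith [hb w hw, norm_nonneg (k 0)]
  refine ⟨dslope k 0 0, fun w => ?_⟩
  have h := sub_smul_dslope k 0 w
  rw [hd.apply_eq_apply_of_bounded hbd w 0, sub_zero, smul_eq_mul] at h
  linear_combination -h

/-- An entire function with an entire left inverse is affine. -/
theorem exists_affine_of_entire_leftInverse {h g : ℂ → ℂ} (hh : Differentiable ℂ h)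
    (hg : Differentiable ℂ g) (hgh : Function.LeftInverse g h) :
    ∃ a : ℂ, a ≠ 0 ∧ ∀ w, h w = a * w + h 0 := by
  have hd := hh.dslope 0
  have hmul (w : ℂ) : w * dslope h 0 w = h w - h 0 := by
    simpa using sub_smul_dslope h 0 w
  have hne (w : ℂ) : dslope h 0 w ≠ 0 := by
    rcases eq_or_ne w 0 with rfl | hw
    · rw [dslope_same]
      intro h0
      have hcomp := (hg (h 0)).hasDerivAt.comp (0 : ℂ) (hh 0).hasDerivAt
      rw [hgh.comp_eq_id, h0, mul_zero] at hcomp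
      exact zero_ne_one (hcomp.unique (hasDerivAt_id 0))
    · intro h0
      have := hmul w
      rw [h0, mul_zero] at this
      exact hw (hgh.injective (sub_eq_zero.1 this.symm))
  obtain ⟨C, hC⟩ := (isCompact_closedBall (h 0) 1).exists_bound_of_continuousOn
    hg.continuous.continuousOn
  obtain ⟨c, hc⟩ := eq_add_mul_of_linear_growth (k := fun w => (dslope h 0 w)⁻¹)
    (hd.inv hne) (le_max_right C 1) (fun w hw => by
      have h1 : 1 ≤ ‖h w - h 0‖ := by
        by_contra! hlt
        have := hC (h w) (by rw [mem_closedBall, dist_eq_norm]; exact hlt.le)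
        rw [hgh w] at this
        exact absurd hw (not_lt.2 (this.trans (le_max_left _ _)))
      rw [← hmul w, norm_mul] at h1
      rw [norm_inv]
      exact (inv_le_iff_one_le_mul₀ (norm_pos_iff.2 (hne w))).2 h1)
  have hc0 : c = 0 := by
    by_contra hc0
    have := hc (-((dslope h 0 0)⁻¹) / c)
    rw [mul_div_cancel₀ _ hc0, add_neg_cancel] at this
    exact inv_ne_zero (hne _) this
  refine ⟨dslope h 0 0, hne 0, fun w => ?_⟩
  have hw := hc w
  rw [hc0, zero_mul, add_zero, inv_inj] at hw
  rw [← hw]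
  linear_combination -hmul w

/-- An entire function on `ℂ²` that is bounded on a cylinder over a disc depends on the base
variable only. -/
theorem eq_of_bounded_on_cylinder {F : ℂ × ℂ → ℂ} (hF : Differentiable ℂ F) {r C : ℝ} (hr : 0 < r)
    (hb : ∀ z w, ‖z‖ ≤ r → ‖F (z, w)‖ ≤ C) (z w : ℂ) : F (z, w) = F (z, 0) := by
  have hslice (w : ℂ) : Differentiable ℂ fun z => F (z, w) := by fun_prop
  refine congrFun ((hslice w).differentiableOn.analyticOnNhd isOpen_univ
    |>.eq_of_eventuallyEq (z₀ := 0) ((hslice 0).differentiableOn.analyticOnNhd isOpen_univ) ?_) z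
  filter_upwards [closedBall_mem_nhds (0 : ℂ) hr] with x hx
  have hx' : Differentiable ℂ fun w => F (x, w) := by fun_prop
  refine hx'.apply_eq_apply_of_bounded (isBounded_iff_forall_norm_le.2 ⟨C, ?_⟩) w 0
  rintro _ ⟨w, rfl⟩
  exact hb x w (by simpa using hx)

/-- An affine map sending the closed disc of radius `r` about the origin into itself satisfies
`‖a‖ r + ‖b‖ ≤ r`. -/
theorem norm_mul_add_norm_le_of_mapsTo_disc {a b : ℂ} {r : ℝ} (hr : 0 < r)
    (h : ∀ z : ℂ, ‖z‖ ≤ r → ‖a * z + b‖ ≤ r) : ‖a‖ * r + ‖b‖ ≤ r := by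
  rcases eq_or_ne a 0 with rfl | ha
  · simpa using h 0 (by simpa using hr.le)
  have ha' : (‖a‖ : ℂ) ≠ 0 := by simpa using ha
  obtain ⟨u, hu, hub⟩ : ∃ u : ℂ, ‖u‖ = 1 ∧ b = ‖b‖ * u := by
    refine ⟨exp (arg b * I), norm_exp_ofReal_mul_I _, (norm_mul_exp_arg_mul_I b).symm⟩
  have haz : a * (r * ‖a‖ * u / a) + b = ((‖a‖ * r + ‖b‖ : ℝ) : ℂ) * u := by
    rw [mul_div_cancel₀ _ ha]
    push_cast
    linear_combination hub
  have hz := h (r * ‖a‖ * u / a) (by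
    have := norm_ne_zero_iff.2 ha
    simp [hu, abs_of_pos hr, this])
  rw [haz, norm_mul, hu, mul_one, norm_real] at hz
  exact (le_abs_self _).trans hz

/-- A holomorphic automorphism of `ℂ` that preserves a closed disc about the origin is a
rotation. -/
theorem exists_rotation_of_preserves_disc {f g : ℂ → ℂ} (hf : Differentiable ℂ f)
    (hg : Differentiable ℂ g) (hgf : Function.LeftInverse g f) (hfg : Function.RightInverse g f)
    {r : ℝ} (hr : 0 < r) (hfr : ∀ z, ‖z‖ ≤ r → ‖f z‖ ≤ r) (hgr : ∀ z, ‖z‖ ≤ r → ‖g z‖ ≤ r) :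
    ∃ φ : ℝ, ∀ z, f z = exp (φ * I) * z := by
  obtain ⟨a, ha, hfa⟩ := exists_affine_of_entire_leftInverse hf hg hgf
  have hga (z : ℂ) : g z = a⁻¹ * z + -(a⁻¹ * f 0) := by
    have := hfa (g z)
    rw [hfg z] at this
    field_simp
    linear_combination -this
  have h1 := norm_mul_add_norm_le_of_mapsTo_disc hr fun z hz => hfa z ▸ hfr z hz
  have h2 := norm_mul_add_norm_le_of_mapsTo_disc hr fun z hz => hga z ▸ hgr z hz
  have ha' : 0 < ‖a‖ := norm_pos_iff.2 ha
  rw [norm_neg, norm_mul, norm_inv, ← mul_add, inv_mul_le_iff₀ ha'] at h2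
  have hb : f 0 = 0 := norm_le_zero_iff.1 (by linarith)
  rw [hb, norm_zero, add_zero] at h1 h2
  have hn : ‖a‖ = 1 := by nlinarith
  refine ⟨arg a, fun z => ?_⟩
  have := norm_mul_exp_arg_mul_I a
  rw [hn, ofReal_one, one_mul] at this
  rw [this, hfa z, hb, add_zero]

/-- The first component of an entire self-map of `ℂ²` preserving a cylinder over a disc does not
depend on the second variable. -/
theorem fst_eq_of_mapsTo_cylinder {ψ : ℂ × ℂ → ℂ × ℂ} (hψ : Differentiable ℂ ψ) {r : ℝ}
    (hr : 0 < r) (hm : ∀ q : ℂ × ℂ, ‖q.1‖ ≤ r → ‖(ψ q).1‖ ≤ r) (z w : ℂ) :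
    (ψ (z, w)).1 = (ψ (z, 0)).1 :=
  eq_of_bounded_on_cylinder (F := fun q => (ψ q).1) (by fun_prop) hr
    (fun z w hz => hm (z, w) hz) z w

/-- The characterisation (5.2) of holomorphic automorphisms of `ℂ²` preserving
`D̄ × ℂ`: they are exactly the maps
`(z, w) ↦ (e^{iφ} z, 𝒢(z)w + ℋ(z))` with `𝒢, ℋ` entire and `𝒢` nowhere
vanishing. -/
theorem aut_preserving_cylinder_iff (r : ℝ) (hr : 0 < r)
    (ψ : ℂ × ℂ → ℂ × ℂ) :
    (Differentiable ℂ ψ ∧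
      (∃ ψinv : ℂ × ℂ → ℂ × ℂ, Differentiable ℂ ψinv ∧
        Function.LeftInverse ψinv ψ ∧ Function.RightInverse ψinv ψ) ∧
      ψ '' (closedBall (0 : ℂ) r ×ˢ (Set.univ : Set ℂ)) =
        closedBall (0 : ℂ) r ×ˢ (Set.univ : Set ℂ)) ↔
    (∃ φ : ℝ, ∃ G H : ℂ → ℂ, Differentiable ℂ G ∧ Differentiable ℂ H ∧
      (∀ z : ℂ, G z ≠ 0) ∧
      ∀ q : ℂ × ℂ, ψ q = (Complex.exp ((φ : ℂ) * Complex.I) * q.1,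
        G q.1 * q.2 + H q.1)) := by
  constructor
  · rintro ⟨hψ, ⟨χ, hχ, hl, hrt⟩, him⟩
    have hψr (q : ℂ × ℂ) (hq : ‖q.1‖ ≤ r) : ‖(ψ q).1‖ ≤ r := by
      have : ψ q ∈ closedBall (0 : ℂ) r ×ˢ (Set.univ : Set ℂ) :=
        him ▸ Set.mem_image_of_mem ψ (by simpa using hq)
      simpa using this
    have hχr (q : ℂ × ℂ) (hq : ‖q.1‖ ≤ r) : ‖(χ q).1‖ ≤ r := by
      have : q ∈ ψ '' (closedBall (0 : ℂ) r ×ˢ (Set.univ : Set ℂ)) := by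
        rw [him]
        simpa using hq
      obtain ⟨p, hp, rfl⟩ := this
      rw [hl p]
      simpa using hp
    have hψ1 := fst_eq_of_mapsTo_cylinder hψ hr hψr
    have hχ1 := fst_eq_of_mapsTo_cylinder hχ hr hχr
    have hgf : Function.LeftInverse (fun z => (χ (z, 0)).1) fun z => (ψ (z, 0)).1 := fun z => by
      change (χ ((ψ (z, 0)).1, 0)).1 = z
      rw [← hχ1 _ (ψ (z, 0)).2, Prod.mk.eta, hl]
    have hfg : Function.RightInverse (fun z => (χ (z, 0)).1) fun z => (ψ (z, 0)).1 := fun z => by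
      change (ψ ((χ (z, 0)).1, 0)).1 = z
      rw [← hψ1 _ (χ (z, 0)).2, Prod.mk.eta, hrt]
    obtain ⟨φ, hφ⟩ := exists_rotation_of_preserves_disc (f := fun z => (ψ (z, 0)).1)
      (g := fun z => (χ (z, 0)).1) (by fun_prop) (by fun_prop) hgf hfg hr
      (fun z => hψr (z, 0)) (fun z => hχr (z, 0))
    have haff (z : ℂ) : ∃ a : ℂ, a ≠ 0 ∧ ∀ w, (ψ (z, w)).2 = a * w + (ψ (z, 0)).2 := by
      refine exists_affine_of_entire_leftInverse (h := fun w => (ψ (z, w)).2)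
        (g := fun w => (χ ((ψ (z, 0)).1, w)).2) (by fun_prop) (by fun_prop) fun w => ?_
      change (χ ((ψ (z, 0)).1, (ψ (z, w)).2)).2 = w
      rw [← hψ1 z w, Prod.mk.eta, hl]
    refine ⟨φ, fun z => (ψ (z, 1)).2 - (ψ (z, 0)).2, fun z => (ψ (z, 0)).2, by fun_prop,
      by fun_prop, fun z => ?_, fun q => ?_⟩
    · obtain ⟨a, ha, h⟩ := haff z
      simpa [h 1] using ha
    · obtain ⟨z, w⟩ := q
      obtain ⟨a, ha, h⟩ := haff z
      refine Prod.ext ((hψ1 z w).trans (hφ z)) ?_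
      simp [h 1, h w]
  · rintro ⟨φ, G, H, hG, hH, hG0, hψ⟩
    obtain rfl : ψ = _ := funext hψ
    have hn (z : ℂ) : ‖exp (-(φ * I)) * z‖ = ‖z‖ := by
      rw [norm_mul, ← neg_mul, ← ofReal_neg, norm_exp_ofReal_mul_I, one_mul]
    have hcancel (z : ℂ) : exp (φ * I) * (exp (-(φ * I)) * z) = z := by
      rw [← mul_assoc, ← exp_add, add_neg_cancel, exp_zero, one_mul]
    have hcancel' (z : ℂ) : exp (-(φ * I)) * (exp (φ * I) * z) = z := by
      rw [← mul_assoc, ← exp_add, neg_add_cancel, exp_zero, one_mul]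
    let χ : ℂ × ℂ → ℂ × ℂ := fun q =>
      (exp (-(φ * I)) * q.1, (q.2 - H (exp (-(φ * I)) * q.1)) / G (exp (-(φ * I)) * q.1))
    have hrt (q : ℂ × ℂ) : (exp (φ * I) * (χ q).1, G (χ q).1 * (χ q).2 + H (χ q).1) = q := by
      refine Prod.ext (hcancel q.1) ?_
      simp only [χ]
      rw [mul_div_cancel₀ _ (hG0 _), sub_add_cancel]
    refine ⟨by fun_prop, ⟨χ, ?_, fun q => ?_, hrt⟩, ?_⟩
    · have hnum : Differentiable ℂ fun q : ℂ × ℂ => q.2 - H (exp (-(φ * I)) * q.1) := by fun_prop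
      have hden : Differentiable ℂ fun q : ℂ × ℂ => G (exp (-(φ * I)) * q.1) := by fun_prop
      refine Differentiable.prodMk (by fun_prop) ?_
      simp only [div_eq_mul_inv]
      exact hnum.fun_mul (hden.fun_inv fun q => hG0 _)
    · refine Prod.ext (hcancel' q.1) ?_
      simp only [χ, hcancel']
      rw [add_sub_cancel_right, mul_div_cancel_left₀ _ (hG0 _)]
    · refine Set.Subset.antisymm ?_ fun q hq => ⟨χ q, ?_, hrt q⟩
      · rintro _ ⟨q, hq, rfl⟩
        simpa [norm_exp_ofReal_mul_I] using hq
      · have : ‖(χ q).1‖ ≤ r := (hn q.1).trans_le (by simpa using hq)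
        simpa using this
end

section
/- Let D̄ be a closed disc in ℂ with centre 0. Suppose F : D̄ → ℂ is of Hölder class C^α(D̄), 0 < α < 1, and satisfies the hypothesis of the main Hölder theorem with data: a nowhere-dense set E ⊂ D̄, a nowhere-vanishing A ∈ 𝒪(D̄), constants M, K > 0, ν ≥ 1, and, for each ζ ∈ D̄ \ E, a function G_ζ ∈ 𝒪_ζ(D̄) with |G_ζ(z)| ≤ M|z − ζ| on D̄ and a constant C_ζ of modulus 1 with C_ζ·(z − ζ)·(A(z)F(z) − A(ζ)F(ζ) + G_ζ(z)) ∈ W(K, ν) for all z ∈ D̄. Let φ ∈ ℝ and let 𝒢, ℋ : ℂ → ℂ be entire with 𝒢 nowhere vanishing, and define F̃(z) := 𝒢(e^{−iφ}z)·F(e^{−iφ}z) + ℋ(e^{−iφ}z) for z ∈ D̄. Then: (i) F̃ ∈ C^α(D̄); (ii) the map ψ(z, w) := (e^{iφ}z, 𝒢(z)w + ℋ(z)) sends Graph_{D̄}(F) onto Graph_{D̄}(F̃); and (iii) F̃ satisfies the same hypothesis with the same constants K and ν, namely with the nowhere-dense set Ẽ := e^{iφ}E, the nowhere-vanishing function Ã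 := (A/𝒢)(e^{−iφ}·) ∈ 𝒪(D̄), some constant M̃ > 0, and, for each ζ ∈ D̄ \ Ẽ, the constant C̃_ζ := e^{−iφ}·C_{e^{−iφ}ζ} of modulus 1 and the function G̃_ζ(z) := G_{e^{−iφ}ζ}(e^{−iφ}z) − (Aℋ/𝒢)(e^{−iφ}z) + (Aℋ/𝒢)(e^{−iφ}ζ) ∈ 𝒪_ζ(D̄) with |G̃_ζ(z)| ≤ M̃|z − ζ| on D̄, such that C̃_ζ·(z − ζ)·(Ã(z)F̃(z) − Ã(ζ)F̃(ζ) + G̃_ζ(z)) ∈ W(K, ν) for all z ∈ D̄. -/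
open Complex Metric

def graphOn (S : Set ℂ) (F : ℂ → ℂ) : Set (ℂ × ℂ) := {q | q.1 ∈ S ∧ q.2 = F q.1}

def HolderOn (F : ℂ → ℂ) (α : ℝ) (S : Set ℂ) : Prop :=
  ∃ c : ℝ, 0 ≤ c ∧ ∀ z ∈ S, ∀ w ∈ S, ‖F z - F w‖ ≤ c * ‖z - w‖ ^ α

/-- Membership in `𝒪(S)`: holomorphic on some open neighbourhood of `S`. -/
def HoloNear (A : ℂ → ℂ) (S : Set ℂ) : Prop :=
  ∃ U : Set ℂ, IsOpen U ∧ S ⊆ U ∧ DifferentiableOn ℂ A U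

/-- The wedge `W(K, ν) = {u + iv : u ≥ 0, |v| ≤ K u^{1/ν}}`. -/
noncomputable def wedge (K ν : ℝ) : Set ℂ :=
  {w : ℂ | 0 ≤ w.re ∧ |w.im| ≤ K * w.re ^ (1 / ν)}

/-- Rotation of `ℂ` by angle `φ`: `z ↦ e^{iφ} z`. -/
noncomputable def rot (φ : ℝ) (z : ℂ) : ℂ := Complex.exp ((φ : ℂ) * Complex.I) * z

/-- The transformed function `F̃(z) = 𝒢(e^{−iφ}z) F(e^{−iφ}z) + ℋ(e^{−iφ}z)`. -/
noncomputable def transF (φ : ℝ) (𝒢 ℋ F : ℂ → ℂ) (z : ℂ) : ℂ :=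
  𝒢 (rot (-φ) z) * F (rot (-φ) z) + ℋ (rot (-φ) z)

/-- The transformed function `Ã = (A/𝒢)(e^{−iφ}·)`. -/
noncomputable def transA (φ : ℝ) (𝒢 A : ℂ → ℂ) (z : ℂ) : ℂ :=
  A (rot (-φ) z) / 𝒢 (rot (-φ) z)

/-- The transformed functions
`G̃_ζ = G_{e^{−iφ}ζ}(e^{−iφ}·) − (Aℋ/𝒢)(e^{−iφ}·) + (Aℋ/𝒢)(e^{−iφ}ζ)`. -/
noncomputable def transG (φ : ℝ) (𝒢 ℋ A : ℂ → ℂ) (G : ℂ → ℂ → ℂ) (ζ z : ℂ) : ℂ :=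
  G (rot (-φ) ζ) (rot (-φ) z)
    - A (rot (-φ) z) * ℋ (rot (-φ) z) / 𝒢 (rot (-φ) z)
    + A (rot (-φ) ζ) * ℋ (rot (-φ) ζ) / 𝒢 (rot (-φ) ζ)

/-- The transformed constants `C̃_ζ = e^{−iφ} C_{e^{−iφ}ζ}`. -/
noncomputable def transC (φ : ℝ) (C : ℂ → ℂ) (ζ : ℂ) : ℂ :=
  Complex.exp ((-φ : ℂ) * Complex.I) * C (rot (-φ) ζ)

lemma rot_neg_rot (φ : ℝ) (z : ℂ) : rot (-φ) (rot φ z) = z := by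
  simp only [rot, ← mul_assoc, ← Complex.exp_add]
  simp

lemma rot_rot_neg (φ : ℝ) (z : ℂ) : rot φ (rot (-φ) z) = z := by
  simpa using rot_neg_rot (-φ) z

lemma norm_rot (φ : ℝ) (z : ℂ) : ‖rot φ z‖ = ‖z‖ := by
  rw [rot, norm_mul, Complex.norm_exp_ofReal_mul_I, one_mul]

lemma rot_sub (φ : ℝ) (z w : ℂ) : rot φ z - rot φ w = rot φ (z - w) := by
  simp only [rot, mul_sub]

lemma norm_rot_sub_rot (φ : ℝ) (z w : ℂ) : ‖rot φ z - rot φ w‖ = ‖z - w‖ := by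
  rw [rot_sub, norm_rot]

lemma differentiable_rot (φ : ℝ) : Differentiable ℂ (rot φ) :=
  differentiable_id.const_mul _

lemma rot_mem_closedBall (φ : ℝ) {r : ℝ} {z : ℂ} (hz : z ∈ closedBall (0 : ℂ) r) :
    rot φ z ∈ closedBall (0 : ℂ) r := by
  simpa [norm_rot] using hz

/-- Rotation as a homeomorphism of the plane. -/
noncomputable def rotHomeomorph (φ : ℝ) : ℂ ≃ₜ ℂ where
  toFun := rot φ
  invFun := rot (-φ)
  left_inv := rot_neg_rot φ
  right_inv := rot_rot_neg φ
  continuous_toFun := (differentiable_rot φ).continuous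
  continuous_invFun := (differentiable_rot (-φ)).continuous

lemma isNowhereDense_image_rot (φ : ℝ) {E : Set ℂ} (hE : IsNowhereDense E) :
    IsNowhereDense (rot φ '' E) := by
  change interior (closure (rotHomeomorph φ '' E)) = ∅
  rw [← Homeomorph.image_closure, ← Homeomorph.image_interior, hE, Set.image_empty]

lemma rot_neg_notMem {φ : ℝ} {E : Set ℂ} {ζ : ℂ} (hζ : ζ ∉ rot φ '' E) : rot (-φ) ζ ∉ E :=
  fun h => hζ ⟨_, h, rot_rot_neg φ ζ⟩

namespace HoloNear

variable {f g : ℂ → ℂ} {S : Set ℂ}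

lemma of_differentiable (hf : Differentiable ℂ f) (S : Set ℂ) : HoloNear f S :=
  ⟨Set.univ, isOpen_univ, Set.subset_univ S, hf.differentiableOn⟩

lemma add (hf : HoloNear f S) (hg : HoloNear g S) : HoloNear (fun z => f z + g z) S := by
  obtain ⟨U, hU, hSU, hfU⟩ := hf
  obtain ⟨V, hV, hSV, hgV⟩ := hg
  exact ⟨U ∩ V, hU.inter hV, Set.subset_inter hSU hSV,
    (hfU.mono Set.inter_subset_left).add (hgV.mono Set.inter_subset_right)⟩

lemma sub (hf : HoloNear f S) (hg : HoloNear g S) : HoloNear (fun z => f z - g z) S := by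
  obtain ⟨U, hU, hSU, hfU⟩ := hf
  obtain ⟨V, hV, hSV, hgV⟩ := hg
  exact ⟨U ∩ V, hU.inter hV, Set.subset_inter hSU hSV,
    (hfU.mono Set.inter_subset_left).sub (hgV.mono Set.inter_subset_right)⟩

lemma mul_differentiable (hf : HoloNear f S) (hg : Differentiable ℂ g) :
    HoloNear (fun z => f z * g z) S := by
  obtain ⟨U, hU, hSU, hfU⟩ := hf
  exact ⟨U, hU, hSU, hfU.mul hg.differentiableOn⟩

lemma div_differentiable (hf : HoloNear f S) (hg : Differentiable ℂ g) (hg0 : ∀ z, g z ≠ 0) :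
    HoloNear (fun z => f z / g z) S := by
  obtain ⟨U, hU, hSU, hfU⟩ := hf
  exact ⟨U, hU, hSU, hfU.div hg.differentiableOn fun z _ => hg0 z⟩

lemma comp_rot {r : ℝ} (hf : HoloNear f (closedBall 0 r)) (φ : ℝ) :
    HoloNear (fun z => f (rot φ z)) (closedBall 0 r) := by
  obtain ⟨U, hU, hSU, hfU⟩ := hf
  exact ⟨rot φ ⁻¹' U, hU.preimage (differentiable_rot φ).continuous,
    fun z hz => hSU (rot_mem_closedBall φ hz),
    hfU.comp (differentiable_rot φ).differentiableOn (Set.mapsTo_preimage _ _)⟩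

/-- A function holomorphic near a compact convex set is Lipschitz on it. -/
lemma exists_lipschitz (hf : HoloNear f S) (hS : IsCompact S) (hconv : Convex ℝ S) :
    ∃ L : ℝ, 0 ≤ L ∧ ∀ z ∈ S, ∀ w ∈ S, ‖f z - f w‖ ≤ L * ‖z - w‖ := by
  obtain ⟨U, hU, hSU, hfU⟩ := hf
  obtain ⟨L, hL⟩ :=
    hS.exists_bound_of_continuousOn ((hfU.deriv hU).continuousOn.mono hSU)
  refine ⟨|L|, abs_nonneg L, fun z hz w hw => ?_⟩
  exact hconv.norm_image_sub_le_of_norm_deriv_le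
    (fun x hx => hfU.differentiableAt (hU.mem_nhds (hSU hx)))
    (fun x hx => (hL x hx).trans (le_abs_self L)) hw hz

end HoloNear

namespace HolderOn

variable {f g : ℂ → ℂ} {α : ℝ} {S : Set ℂ}

lemma add (hf : HolderOn f α S) (hg : HolderOn g α S) :
    HolderOn (fun z => f z + g z) α S := by
  obtain ⟨c, hc, hfc⟩ := hf
  obtain ⟨d, hd, hgd⟩ := hg
  refine ⟨c + d, add_nonneg hc hd, fun z hz w hw => ?_⟩
  calc ‖f z + g z - (f w + g w)‖ = ‖(f z - f w) + (g z - g w)‖ := by ring_nf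
    _ ≤ ‖f z - f w‖ + ‖g z - g w‖ := norm_add_le _ _
    _ ≤ c * ‖z - w‖ ^ α + d * ‖z - w‖ ^ α := add_le_add (hfc z hz w hw) (hgd z hz w hw)
    _ = (c + d) * ‖z - w‖ ^ α := by ring

lemma exists_norm_le {r : ℝ} (hα : 0 ≤ α) (hr : 0 ≤ r) (hf : HolderOn f α (closedBall 0 r)) :
    ∃ B : ℝ, 0 ≤ B ∧ ∀ z ∈ closedBall (0 : ℂ) r, ‖f z‖ ≤ B := by
  obtain ⟨c, hc, hfc⟩ := hf
  refine ⟨c * r ^ α + ‖f 0‖, by positivity, fun z hz => ?_⟩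
  have hzr : ‖z‖ ≤ r := by simpa using hz
  calc ‖f z‖ ≤ ‖f z - f 0‖ + ‖f 0‖ := norm_le_norm_sub_add _ _
    _ ≤ c * ‖z - 0‖ ^ α + ‖f 0‖ := by gcongr; exact hfc z hz 0 (by simpa using hr)
    _ ≤ c * r ^ α + ‖f 0‖ := by rw [sub_zero]; gcongr

lemma mul {r : ℝ} (hα : 0 ≤ α) (hr : 0 ≤ r) (hf : HolderOn f α (closedBall 0 r))
    (hg : HolderOn g α (closedBall 0 r)) :
    HolderOn (fun z => f z * g z) α (closedBall 0 r) := by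
  obtain ⟨a, ha, hfa⟩ := hf.exists_norm_le hα hr
  obtain ⟨b, hb, hgb⟩ := hg.exists_norm_le hα hr
  obtain ⟨c, hc, hfc⟩ := hf
  obtain ⟨d, hd, hgd⟩ := hg
  refine ⟨c * b + a * d, by positivity, fun z hz w hw => ?_⟩
  calc ‖f z * g z - f w * g w‖ = ‖(f z - f w) * g z + f w * (g z - g w)‖ := by ring_nf
    _ ≤ ‖f z - f w‖ * ‖g z‖ + ‖f w‖ * ‖g z - g w‖ := by
      simpa only [norm_mul] using norm_add_le ((f z - f w) * g z) (f w * (g z - g w))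
    _ ≤ (c * ‖z - w‖ ^ α) * b + a * (d * ‖z - w‖ ^ α) := by
      gcongr
      exacts [hfc z hz w hw, hgb z hz, hfa w hw, hgd z hz w hw]
    _ = (c * b + a * d) * ‖z - w‖ ^ α := by ring

lemma comp_rot {r : ℝ} (hf : HolderOn f α (closedBall 0 r)) (φ : ℝ) :
    HolderOn (fun z => f (rot φ z)) α (closedBall 0 r) := by
  obtain ⟨c, hc, hfc⟩ := hf
  refine ⟨c, hc, fun z hz w hw => ?_⟩
  rw [← norm_rot_sub_rot φ z w]
  exact hfc _ (rot_mem_closedBall φ hz) _ (rot_mem_closedBall φ hw)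

end HolderOn

lemma HoloNear.holderOn {f : ℂ → ℂ} {r α : ℝ} (hf : HoloNear f (closedBall 0 r)) (hα : α ≤ 1) :
    HolderOn f α (closedBall 0 r) := by
  obtain ⟨L, hL, hfL⟩ := hf.exists_lipschitz (isCompact_closedBall _ _) (convex_closedBall _ _)
  refine ⟨L * |2 * r| ^ (1 - α), by positivity, fun z hz w hw => ?_⟩
  rcases eq_or_ne z w with rfl | hzw
  · simp only [sub_self, norm_zero]; positivity
  have hpos : 0 < ‖z - w‖ := norm_pos_iff.2 (sub_ne_zero.2 hzw)
  have hle : ‖z - w‖ ≤ |2 * r| := by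
    have hz' : ‖z‖ ≤ r := by simpa using hz
    have hw' : ‖w‖ ≤ r := by simpa using hw
    linarith [norm_sub_le z w, le_abs_self (2 * r)]
  have hsplit : ‖z - w‖ = ‖z - w‖ ^ (1 - α) * ‖z - w‖ ^ α := by
    rw [← Real.rpow_add hpos, sub_add_cancel, Real.rpow_one]
  calc ‖f z - f w‖ ≤ L * ‖z - w‖ := hfL z hz w hw
    _ = L * (‖z - w‖ ^ (1 - α) * ‖z - w‖ ^ α) := by rw [← hsplit]
    _ ≤ L * (|2 * r| ^ (1 - α) * ‖z - w‖ ^ α) := by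
      gcongr
    _ = L * |2 * r| ^ (1 - α) * ‖z - w‖ ^ α := by ring

lemma image_graphOn_eq (φ r : ℝ) (𝒢 ℋ F : ℂ → ℂ) :
    (fun q : ℂ × ℂ => (rot φ q.1, 𝒢 q.1 * q.2 + ℋ q.1)) '' graphOn (closedBall 0 r) F =
      graphOn (closedBall 0 r) (transF φ 𝒢 ℋ F) := by
  ext ⟨z, w⟩
  constructor
  · rintro ⟨⟨x, y⟩, ⟨hx, rfl : y = F x⟩, h⟩
    obtain ⟨rfl, rfl⟩ := Prod.ext_iff.1 h
    exact ⟨rot_mem_closedBall φ hx, by simp only [transF, rot_neg_rot]⟩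
  · rintro ⟨hz, rfl : w = transF φ 𝒢 ℋ F z⟩
    exact ⟨(rot (-φ) z, F (rot (-φ) z)), ⟨rot_mem_closedBall _ hz, rfl⟩,
      Prod.ext (rot_rot_neg φ z) rfl⟩

lemma transC_mul_sub (φ : ℝ) (C : ℂ → ℂ) (ζ z : ℂ) :
    transC φ C ζ * (z - ζ) = C (rot (-φ) ζ) * (rot (-φ) z - rot (-φ) ζ) := by
  simp only [transC, rot, Complex.ofReal_neg]
  ring

lemma norm_transC (φ : ℝ) (C : ℂ → ℂ) (ζ : ℂ) : ‖transC φ C ζ‖ = ‖C (rot (-φ) ζ)‖ := by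
  rw [transC, norm_mul, ← Complex.ofReal_neg, Complex.norm_exp_ofReal_mul_I, one_mul]

lemma transA_mul_transF_sub_add_transG {𝒢 : ℂ → ℂ} (h𝒢0 : ∀ z, 𝒢 z ≠ 0) (φ : ℝ)
    (ℋ F A : ℂ → ℂ) (G : ℂ → ℂ → ℂ) (ζ z : ℂ) :
    transA φ 𝒢 A z * transF φ 𝒢 ℋ F z - transA φ 𝒢 A ζ * transF φ 𝒢 ℋ F ζ +
        transG φ 𝒢 ℋ A G ζ z =
      A (rot (-φ) z) * F (rot (-φ) z) - A (rot (-φ) ζ) * F (rot (-φ) ζ) +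
        G (rot (-φ) ζ) (rot (-φ) z) := by
  have hz := h𝒢0 (rot (-φ) z)
  have hζ := h𝒢0 (rot (-φ) ζ)
  simp only [transA, transF, transG]
  field_simp
  ring

/-- Functoriality of the hypothesis of Theorem 1.1 under the automorphisms
`ψ(z, w) = (e^{iφ}z, 𝒢(z)w + ℋ(z))` of `ℂ²` preserving `D̄ × ℂ`. -/
theorem holder_hypothesis_functorial (r α M K ν : ℝ) (hr : 0 < r)
    (hα0 : 0 < α) (hα1 : α < 1)
    (F A : ℂ → ℂ) (E : Set ℂ) (G : ℂ → ℂ → ℂ) (C : ℂ → ℂ)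
    (hF : HolderOn F α (closedBall 0 r))
    (hE : E ⊆ closedBall 0 r) (hEnd : IsNowhereDense E)
    (hA : HoloNear A (closedBall 0 r))
    (hA0 : ∀ z ∈ closedBall (0 : ℂ) r, A z ≠ 0)
    (hM : 0 < M) (hK : 0 < K) (hν : 1 ≤ ν)
    (hG : ∀ ζ ∈ closedBall (0 : ℂ) r \ E,
      HoloNear (G ζ) (closedBall 0 r) ∧ G ζ ζ = 0 ∧
        ∀ z ∈ closedBall (0 : ℂ) r, ‖G ζ z‖ ≤ M * ‖z - ζ‖)
    (hC : ∀ ζ ∈ closedBall (0 : ℂ) r \ E,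
      ‖C ζ‖ = 1 ∧
        ∀ z ∈ closedBall (0 : ℂ) r,
          C ζ * (z - ζ) * (A z * F z - A ζ * F ζ + G ζ z) ∈ wedge K ν)
    (φ : ℝ) (𝒢 ℋ : ℂ → ℂ)
    (h𝒢 : Differentiable ℂ 𝒢) (hℋ : Differentiable ℂ ℋ)
    (h𝒢0 : ∀ z : ℂ, 𝒢 z ≠ 0) :
    -- (i) `F̃ ∈ C^α(D̄)`:
    HolderOn (transF φ 𝒢 ℋ F) α (closedBall 0 r) ∧
    -- (ii) `ψ(Graph_{D̄}(F)) = Graph_{D̄}(F̃)`: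
    (fun q : ℂ × ℂ => (rot φ q.1, 𝒢 q.1 * q.2 + ℋ q.1)) ''
        graphOn (closedBall 0 r) F =
      graphOn (closedBall 0 r) (transF φ 𝒢 ℋ F) ∧
    -- (iii) `F̃` satisfies the same hypothesis, with the same `K` and `ν`:
    (IsNowhereDense (rot φ '' E) ∧
      rot φ '' E ⊆ closedBall 0 r ∧
      HoloNear (transA φ 𝒢 A) (closedBall 0 r) ∧
      (∀ z ∈ closedBall (0 : ℂ) r, transA φ 𝒢 A z ≠ 0) ∧
      ∃ Mt : ℝ, 0 < Mt ∧
        ∀ ζ ∈ closedBall (0 : ℂ) r \ (rot φ '' E),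
          ‖transC φ C ζ‖ = 1 ∧
          HoloNear (transG φ 𝒢 ℋ A G ζ) (closedBall 0 r) ∧
          transG φ 𝒢 ℋ A G ζ ζ = 0 ∧
          (∀ z ∈ closedBall (0 : ℂ) r, ‖transG φ 𝒢 ℋ A G ζ z‖ ≤ Mt * ‖z - ζ‖) ∧
          ∀ z ∈ closedBall (0 : ℂ) r,
            transC φ C ζ * (z - ζ) *
                (transA φ 𝒢 A z * transF φ 𝒢 ℋ F z -
                  transA φ 𝒢 A ζ * transF φ 𝒢 ℋ F ζ +
                  transG φ 𝒢 ℋ A G ζ z) ∈ wedge K ν) := by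
  have hAHG : HoloNear (fun z => A z * ℋ z / 𝒢 z) (closedBall 0 r) :=
    (hA.mul_differentiable hℋ).div_differentiable h𝒢 h𝒢0
  obtain ⟨L, hL, hLip⟩ :=
    hAHG.exists_lipschitz (isCompact_closedBall _ _) (convex_closedBall _ _)
  refine ⟨?_, image_graphOn_eq φ r 𝒢 ℋ F, isNowhereDense_image_rot φ hEnd, ?_,
    (hA.div_differentiable h𝒢 h𝒢0).comp_rot (-φ),
    fun z hz => div_ne_zero (hA0 _ (rot_mem_closedBall _ hz)) (h𝒢0 _),
    M + L, by positivity, ?_⟩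
  · exact ((((HoloNear.of_differentiable h𝒢 _).holderOn hα1.le).mul hα0.le hr.le hF).add
      ((HoloNear.of_differentiable hℋ _).holderOn hα1.le)).comp_rot (-φ)
  · rintro _ ⟨z, hz, rfl⟩
    exact rot_mem_closedBall φ (hE hz)
  rintro ζ ⟨hζ, hζE⟩
  have hζ' := rot_mem_closedBall (-φ) hζ
  obtain ⟨hGholo, hG0, hGM⟩ := hG _ ⟨hζ', rot_neg_notMem hζE⟩
  obtain ⟨hC1, hCW⟩ := hC _ ⟨hζ', rot_neg_notMem hζE⟩
  refine ⟨(norm_transC φ C ζ).trans hC1, ?_, ?_, fun z hz => ?_, fun z hz => ?_⟩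
  · exact ((hGholo.comp_rot (-φ)).sub (hAHG.comp_rot (-φ))).add
      (HoloNear.of_differentiable (differentiable_const _) _)
  · simp only [transG, hG0]
    ring
  · have hz' := rot_mem_closedBall (-φ) hz
    have h1 := hGM _ hz'
    have h2 := hLip _ hz' _ hζ'
    rw [norm_rot_sub_rot] at h1 h2
    rw [transG, sub_add, add_mul]
    exact (norm_sub_le _ _).trans (add_le_add h1 h2)
  · rw [transC_mul_sub, transA_mul_transF_sub_add_transG h𝒢0]
    exact hCW _ (rot_mem_closedBall _ hz)
end
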